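/- Let X be a second-countable topological space and T : X → X a homeomorphism admitting no nonempty open wandering set. Then the set of points of X that are not recurrent under T is meager (of first category) in X. -/

import Mathlib

/-- An open set `E` is wandering for `T : X → X` if the preimages `T⁻ⁱ(E)`, `i = 0, 1, 2, …`,
are pairwise disjoint. -/
def IsWanderingSet {X : Type*} (T : X → X) (E : Set X) : Prop :=
  ∀ i j : ℕ, i ≠ j → Disjoint (T^[i] ⁻¹' E) (T^[j] ⁻¹' E)

/-- `T` admits no nonempty open wandering set. -/
def HasNoNonemptyOpenWanderingSet {X : Type*} [TopologicalSpace X] (T : X → X) : Prop :=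
  ∀ E : Set X, IsOpen E → E.Nonempty → ¬ IsWanderingSet T E

/-- A point `x` is recurrent under `T` if for every open set `U` containing `x`,
`Tⁱ(x) ∈ U` for infinitely many `i ≥ 0`. -/
def IsRecurrentPoint {X : Type*} [TopologicalSpace X] (T : X → X) (x : X) : Prop :=
  ∀ U : Set X, IsOpen U → x ∈ U → {i : ℕ | T^[i] x ∈ U}.Infinite

open Set

/-- A set that is not wandering contains a point that returns to it at a positive time. -/
theorem exists_pos_return_of_not_isWanderingSet {X : Type*} {T : X → X} {E : Set X}
    (h : ¬ IsWanderingSet T E) : ∃ k, 0 < k ∧ (E ∩ T^[k] ⁻¹' E).Nonempty := by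
  simp only [IsWanderingSet, not_forall, Set.not_disjoint_iff] at h
  obtain ⟨i, j, hij, x, hi, hj⟩ := h
  have key : ∀ a b : ℕ, a < b → T^[a] x ∈ E → T^[b] x ∈ E →
      ∃ k, 0 < k ∧ (E ∩ T^[k] ⁻¹' E).Nonempty := by
    intro a b hab ha hb
    refine ⟨b - a, Nat.sub_pos_of_lt hab, T^[a] x, ha, ?_⟩
    rwa [mem_preimage, ← Function.iterate_add_apply, Nat.sub_add_cancel hab.le]
  rcases lt_or_gt_of_ne hij with hlt | hlt
  · exact key i j hlt hi hj
  · exact key j i hlt hj hi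

/-- Without nonempty open wandering sets, every nonempty open set returns to itself at
arbitrarily large times. -/
theorem HasNoNonemptyOpenWanderingSet.exists_ge_return {X : Type*} [TopologicalSpace X]
    {T : X → X} (hw : HasNoNonemptyOpenWanderingSet T) (hT : Continuous T) (n : ℕ) {W : Set X}
    (hW : IsOpen W) (hne : W.Nonempty) : ∃ i, n ≤ i ∧ (W ∩ T^[i] ⁻¹' W).Nonempty := by
  induction n generalizing W with
  | zero => exact ⟨0, le_rfl, by simpa using hne⟩
  | succ n ih =>
    obtain ⟨k, hk, hkne⟩ := exists_pos_return_of_not_isWanderingSet (hw W hW hne)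
    obtain ⟨i, hi, x, hx, hix⟩ := ih (hW.inter (hW.preimage (hT.iterate k))) hkne
    refine ⟨k + i, by omega, x, hx.1, ?_⟩
    rw [mem_preimage, Function.iterate_add_apply]
    exact hix.2

/-- Without nonempty open wandering sets, the points of an open set `U` that do not return to `U`
from time `n` on form a nowhere dense set. -/
theorem HasNoNonemptyOpenWanderingSet.isNowhereDense_nonreturning {X : Type*}
    [TopologicalSpace X] {T : X → X} (hw : HasNoNonemptyOpenWanderingSet T) (hT : Continuous T)
    {U : Set X} (hU : IsOpen U) (n : ℕ) :
    IsNowhereDense {x | x ∈ U ∧ ∀ i, n ≤ i → T^[i] x ∉ U} := by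
  set F := {x | x ∈ U ∧ ∀ i, n ≤ i → T^[i] x ∉ U}
  have hclosed : IsClosed {x | ∀ i, n ≤ i → T^[i] x ∉ U} := by
    simp only [ofPred_forall]
    exact isClosed_iInter fun i => isClosed_iInter fun _ =>
      (hU.preimage (hT.iterate i)).isClosed_compl
  have hsub : closure F ⊆ {x | ∀ i, n ≤ i → T^[i] x ∉ U} :=
    closure_minimal (fun x hx => hx.2) hclosed
  by_contra hne
  obtain ⟨x, hx⟩ := nonempty_iff_ne_empty.mpr hne
  obtain ⟨y, hyV, hyF⟩ := mem_closure_iff.mp (interior_subset hx) _ isOpen_interior hx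
  obtain ⟨i, hi, z, hz, hiz⟩ :=
    hw.exists_ge_return hT n (isOpen_interior.inter hU) ⟨y, hyV, hyF.1⟩
  exact hsub (interior_subset hz.1) i hi hiz.2

/-- If `X` is second countable and `T` is a homeomorphism of `X` with no nonempty open
wandering set, then the set of non-recurrent points of `X` is meager in `X`. -/
theorem isMeagre_nonrecurrent_of_no_open_wandering_set
    {X : Type*} [TopologicalSpace X] [SecondCountableTopology X] (T : X ≃ₜ X)
    (hw : HasNoNonemptyOpenWanderingSet (⇑T)) :
    IsMeagre {x : X | ¬ IsRecurrentPoint (⇑T) x} := by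
  have hB := TopologicalSpace.isBasis_countableBasis X
  refine IsMeagre.mono (s := ⋃ U ∈ TopologicalSpace.countableBasis X, ⋃ n : ℕ,
    {x | x ∈ U ∧ ∀ i, n ≤ i → T^[i] x ∉ U}) ?_ ?_
  · intro x hx
    simp only [mem_ofPred_eq, IsRecurrentPoint, not_forall, not_infinite] at hx
    obtain ⟨V, hV, hxV, hfin⟩ := hx
    obtain ⟨U, hUB, hxU, hUV⟩ := hB.exists_subset_of_mem_open hxV hV
    obtain ⟨m, hm⟩ := hfin.bddAbove
    simp only [mem_iUnion]
    refine ⟨U, hUB, m + 1, hxU, fun i hi hiU => ?_⟩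
    have := hm (hUV hiU : T^[i] x ∈ V)
    omega
  · exact isMeagre_biUnion (TopologicalSpace.countable_countableBasis X) fun U hU =>
      isMeagre_iUnion fun n =>
        (hw.isNowhereDense_nonreturning T.continuous (hB.isOpen hU) n).isMeagre
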